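/- arXiv:1602.04496 — 9 statements merged into one kernel-verified Lean document; each statement's English description precedes it below -/
import Mathlib

section
/- Let F be a field, let k ≥ 1 and r ≥ 1, set n = k + r, and let α = r·β for a positive integer β. Consider an [n,k] array code with sub-packetization α over F given by encoding matrices A_{i,j} (i ∈ [r], j ∈ [k]), and assume every A_{i,j} is invertible. Fix a failed systematic node f ∈ [k] and matrices S_j ∈ F^{β×α} for every j ∈ [n] with j ≠ f. If x_f is determined by the repair data {S_j x_j : j ∈ [k], j ≠ f} together with {S_{k+i}(Σ_{j=1}^k A_{i,j} x_j) : i ∈ [r]} (i.e., any two data arrays producing equal values of all these linear functions have equal f-th components), then necessarily (a) the rβ×α matrix obtained by stacking S_{k+1}A_{1,f}, …, S_{k+r}A_{r,f} has rank α, and (b) for every j ∈ [k] with j ≠ f, the (r+1)β×α matrix obtained by stacking S_j, S_{k+1}A_{1,j}, …, S_{k+r}A_{r,j} has rank β. -/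
theorem rank_le_of_ker_aux {F : Type*} [Field F] {m m' n : Type*} [Fintype m] [Fintype m']
    [Fintype n] (M : Matrix m n F) (N : Matrix m' n F)
    (h : ∀ v, M.mulVec v = 0 → N.mulVec v = 0) : N.rank ≤ M.rank := by
  have h1 := LinearMap.finrank_range_add_finrank_ker M.mulVecLin
  have h2 := LinearMap.finrank_range_add_finrank_ker N.mulVecLin
  have h3 : M.mulVecLin.ker ≤ N.mulVecLin.ker := by
    intro v hv
    simpa using h v (by simpa using hv)
  have h4 := Submodule.finrank_mono h3
  unfold Matrix.rank
  omega

/-!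
Necessity direction of the interference-alignment lemma (Lemma 1) for
repairing a systematic node of an `[n,k,n-1]` MSR code.

Systematic node `j` (for `j : Fin k`) stores `x j : Fin α → F`; parity node
`k+i` (for `i : Fin r`) stores `∑ j, (A i j).mulVec (x j)`.  The repair matrix
of systematic node `j ≠ f` is `S j : Matrix (Fin β) (Fin α) F`, and the repair
matrix of parity node `k+i` is `T i : Matrix (Fin β) (Fin α) F`.
-/
theorem stmt_1 (F : Type*) [Field F] (k r β α : ℕ)
    (hk : 1 ≤ k) (hr : 1 ≤ r) (hβ : 1 ≤ β) (hα : α = r * β)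
    (A : Fin r → Fin k → Matrix (Fin α) (Fin α) F)
    (hA : ∀ i j, IsUnit (A i j))
    (f : Fin k)
    (S : Fin k → Matrix (Fin β) (Fin α) F)
    (T : Fin r → Matrix (Fin β) (Fin α) F)
    -- `x f` is determined by the repair data
    (hdet : ∀ x x' : Fin k → Fin α → F,
      (∀ j : Fin k, j ≠ f → (S j).mulVec (x j) = (S j).mulVec (x' j)) →
      (∀ i : Fin r,
        (T i).mulVec (∑ j, (A i j).mulVec (x j)) =
        (T i).mulVec (∑ j, (A i j).mulVec (x' j))) →
      x f = x' f) :
    -- (a) signal recovery: the `rβ × α` matrix stacking the `T i * A i f` has rank `α`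
    ((Matrix.of fun (p : Fin r × Fin β) (c : Fin α) =>
        (T p.1 * A p.1 f) p.2 c).rank = α)
    ∧
    -- (b) interference alignment: for `j ≠ f`, the `(r+1)β × α` matrix stacking
    -- `S j` and the `T i * A i j` has rank `β`
    (∀ j : Fin k, j ≠ f →
      (Matrix.of fun (p : Option (Fin r) × Fin β) (c : Fin α) =>
        match p.1 with
        | none => S j p.2 c
        | some i => (T i * A i j) p.2 c).rank = β) := by
  subst hα
  set P : Matrix (Fin r × Fin β) (Fin (r * β)) F :=
    Matrix.of fun (p : Fin r × Fin β) (c : Fin (r * β)) => (T p.1 * A p.1 f) p.2 c with hP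
  have hPv : ∀ u p, P.mulVec u p = (T p.1).mulVec ((A p.1 f).mulVec u) p.2 := by
    intro u p
    rw [Matrix.mulVec_mulVec]
    rfl
  have hinj : ∀ u, P.mulVec u = 0 → u = 0 := by
    intro u hu
    have := hdet (Pi.single f u) 0 (by intro j hj; simp [hj]) (by
      intro i
      rw [Finset.sum_eq_single f]
      · ext b
        have h := congrFun hu (i, b)
        rw [hPv] at h
        simpa using h
      · intro j _ hj; simp [hj]
      · simp)
    simpa using this
  have hinj' : Function.Injective P.mulVecLin := by
    rw [← LinearMap.ker_eq_bot, LinearMap.ker_eq_bot']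
    intro u hu
    exact hinj u (by simpa using hu)
  have hrank : P.rank = r * β := by
    unfold Matrix.rank
    rw [LinearMap.finrank_range_of_inj hinj']
    simp
  have hsurj : Function.Surjective P.mulVecLin :=
    (LinearMap.injective_iff_surjective_of_finrank_eq_finrank (by simp)).1 hinj'
  refine ⟨hrank, ?_⟩
  intro j hj
  set M : Matrix (Option (Fin r) × Fin β) (Fin (r * β)) F :=
    (Matrix.of fun (p : Option (Fin r) × Fin β) (c : Fin (r * β)) =>
        match p.1 with
        | none => S j p.2 c
        | some i => (T i * A i j) p.2 c) with hM
  have hMn : ∀ v b, M.mulVec v (none, b) = (S j).mulVec v b := fun v b => rfl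
  have hMs : ∀ v i b, M.mulVec v (some i, b) = (T i * A i j).mulVec v b := fun v i b => rfl
  apply le_antisymm
  · refine le_trans (rank_le_of_ker_aux (S j) M ?_) (by simpa using (S j).rank_le_card_height)
    intro v hv
    obtain ⟨u, hu⟩ := hsurj (fun p => - (T p.1).mulVec ((A p.1 j).mulVec v) p.2)
    have hu' : ∀ i, (T i).mulVec ((A i f).mulVec u) = - (T i).mulVec ((A i j).mulVec v) := by
      intro i
      ext b
      have := congrFun hu (i, b)
      rw [Matrix.mulVecLin_apply, hPv] at this
      simpa using this
    have h0 := hdet (Pi.single f u + Pi.single j v) 0 (by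
      intro l hl
      by_cases hlj : l = j
      · subst hlj; simp [hl, hv]
      · simp [hl, hlj]) (by
      intro i
      have e : ∀ l (w : Fin (r * β) → F), ∑ l', (A i l').mulVec ((Pi.single l w : Fin k → Fin (r * β) → F) l')
          = (A i l).mulVec w := by
        intro l w
        rw [Finset.sum_eq_single l]
        · simp
        · intro j _ hj; simp [hj]
        · simp
      simp only [Pi.add_apply, Matrix.mulVec_add, Finset.sum_add_distrib, e, hu']
      simp)
    have hu0 : u = 0 := by simpa [hj.symm] using h0
    ext ⟨o, b⟩
    cases o with
    | none => rw [hMn, hv]; rfl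
    | some i =>
      rw [hMs, ← Matrix.mulVec_mulVec]
      have := congrFun (hu' i) b
      simp only [hu0, Matrix.mulVec_zero, Pi.neg_apply, Pi.zero_apply] at this
      simpa using this.symm
  · let i : Fin r := ⟨0, hr⟩
    have h1 : (T i * A i j).rank ≤ M.rank := by
      apply rank_le_of_ker_aux
      intro v hv
      ext b
      rw [← hMs, hv]; rfl
    have h2 : Function.Surjective (T i * A i j).mulVecLin := by
      intro y
      obtain ⟨u, hu⟩ := hsurj (fun p => y p.2)
      refine ⟨((A i j)⁻¹).mulVec ((A i f).mulVec u), ?_⟩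
      have hd : IsUnit (A i j).det := (Matrix.isUnit_iff_isUnit_det _).1 (hA i j)
      rw [Matrix.mulVecLin_apply, Matrix.mulVec_mulVec, Matrix.mul_assoc,
        Matrix.mul_nonsing_inv _ hd, Matrix.mul_one]
      ext b
      have := congrFun hu (i, b)
      rw [Matrix.mulVecLin_apply, hPv] at this
      exact this
    have h3 : (T i * A i j).rank = β := by
      unfold Matrix.rank
      rw [LinearMap.range_eq_top.2 h2]
      simp
    omega
end

section
/- Let F be a field, let k ≥ 1, r ≥ 2, set n = k + r and α = r^k, and index the standard basis of F^α by vectors v ∈ (Z/rZ)^k. Let λ_{i,j} ∈ F be nonzero scalars and define encoding matrices A_{i,j} = λ_{i,j} P_{i−1,j} for i ∈ [r], j ∈ [k], where P_{ℓ,j} is the α×α permutation matrix of the translation v ↦ v + ℓ e_j of (Z/rZ)^k. Consider the [n,k] array code in which systematic node j stores x_j ∈ F^α and parity node k+i stores Σ_{j=1}^k A_{i,j} x_j. Then for every f ∈ [k], the vector x_f is determined by the coordinates indexed by Y_f = {v ∈ (Z/rZ)^k : v_f = 0} of the contents of all n−1 other nodes; that is, if two data arrays (x_1,…,x_k) and (x'_1,…,x'_k)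 satisfy x_j(v) = x'_j(v) for all j ∈ [k] \ {f} and all v ∈ Y_f, and (Σ_j A_{i,j}x_j)(v) = (Σ_j A_{i,j}x'_j)(v) for all i ∈ [r] and all v ∈ Y_f, then x_f = x'_f. Hence node f can be repaired by downloading α/r = r^{k−1} symbols from each of the remaining n−1 nodes, which is the optimal repair bandwidth. -/
/-!
Lemma 3 of the paper: the repair strategy of Construction 1 (the `d = n-1`
construction) achieves the optimal repair bandwidth for every systematic node.

The space `F^α` with `α = r^k` is realized as the function space
`(Fin k → ZMod r) → F`, with coordinates indexed by `v ∈ (ZMod r)^k`.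
Systematic node `j` (for `j : Fin k`) stores `x j`; parity node `k+i`
(for `i : Fin r`, `0`-indexed) stores `∑ j, A i j (x j)` where
`A i j = lam i j • P_{i,j}` and the permutation matrix `P_{i,j}` of the
translation `v ↦ v + i • e_j` acts on functions by
`(P_{i,j} x) v = x (v - Pi.single j i)`.  Thus the `v`-th coordinate of the
content of parity node `k+i` is `∑ j, lam i j * x j (v - Pi.single j i)`.

The claim: the data of a failed node `f` is determined by the coordinates in
`Y_f = {v : v f = 0}` of the contents of the other `n - 1` nodes, i.e. by
`α / r = r^(k-1)` symbols from each of them — the optimal repair bandwidth.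
-/
theorem stmt_5 (F : Type*) [Field F] (k r : ℕ) (hk : 1 ≤ k) (hr : 2 ≤ r)
    (lam : Fin r → Fin k → F) (hlam : ∀ i j, lam i j ≠ 0)
    (f : Fin k)
    (x x' : Fin k → (Fin k → ZMod r) → F)
    -- the two data arrays agree on the `Y_f`-coordinates of every surviving
    -- systematic node
    (hsys : ∀ j : Fin k, j ≠ f → ∀ v : Fin k → ZMod r, v f = 0 → x j v = x' j v)
    -- and on the `Y_f`-coordinates of every parity node
    (hpar : ∀ i : Fin r, ∀ v : Fin k → ZMod r, v f = 0 →
      ∑ j : Fin k, lam i j * x j (v - Pi.single j ((i : ℕ) : ZMod r)) =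
      ∑ j : Fin k, lam i j * x' j (v - Pi.single j ((i : ℕ) : ZMod r))) :
    x f = x' f := by
  haveI : NeZero r := ⟨by omega⟩
  funext w
  have hi : ((-(w f)).val : ZMod r) = -(w f) := ZMod.natCast_zmod_val _
  have h := hpar ⟨(-(w f)).val, ZMod.val_lt _⟩ (w + Pi.single f (-(w f))) (by simp)
  simp only [hi] at h
  rw [← Finset.add_sum_erase _ _ (Finset.mem_univ f),
    ← Finset.add_sum_erase (a := f) _ _ (Finset.mem_univ f)] at h
  have hrest : ∀ j ∈ Finset.univ.erase f,
      x j (w + Pi.single f (-(w f)) - Pi.single j (-(w f))) =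
      x' j (w + Pi.single f (-(w f)) - Pi.single j (-(w f))) := by
    intro j hj
    have hjf : j ≠ f := Finset.ne_of_mem_erase hj
    apply hsys j hjf
    simp [Pi.single_eq_of_ne hjf.symm]
  rw [Finset.sum_congr rfl (fun j hj => by rw [hrest j hj])] at h
  have h2 := mul_left_cancel₀ (hlam _ _) (add_right_cancel h)
  simpa using h2
end

section
/- For all positive integers α, r, k there exists a positive integer N = N(α, r, k) with the following property: for every field F with |F| > N and every family B_{i,j} (i ∈ [r], j ∈ [k]) of invertible α×α matrices over F, there exist nonzero scalars λ_{i,j} ∈ F such that for every t ≥ 1 and all subsets {i_1,…,i_t} ⊆ [r] and {j_1,…,j_t} ⊆ [k] of size t, the tα×tα block matrix whose (s,u) block is λ_{i_s,j_u} B_{i_s,j_u} is invertible. Equivalently, any parity generator matrix with all encoding blocks invertible can be transformed, by multiplying each block by a suitable nonzero scalar over a sufficiently large field, into the parity generator matrix of an [k+r, k] MDS array code. -/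
open MvPolynomial in
/-- The generic block matrix attached to a choice of block rows and columns. -/
noncomputable def genMat {α r k : ℕ} {F : Type} [Field F]
    (B : Fin r → Fin k → Matrix (Fin α) (Fin α) F) {t : ℕ}
    (ai : Fin t → Fin r) (aj : Fin t → Fin k) :
    Matrix (Fin t × Fin α) (Fin t × Fin α) (MvPolynomial (Fin r × Fin k) F) :=
  Matrix.of fun p q => X (ai p.1, aj q.1) * C (B (ai p.1) (aj q.1) p.2 q.2)

open MvPolynomial in
lemma eval_det_genMat {α r k : ℕ} {F : Type} [Field F]
    (B : Fin r → Fin k → Matrix (Fin α) (Fin α) F) {t : ℕ}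
    (ai : Fin t → Fin r) (aj : Fin t → Fin k) (x : Fin r × Fin k → F) :
    eval x (genMat B ai aj).det = (Matrix.of fun (p q : Fin t × Fin α) =>
      x (ai p.1, aj q.1) * B (ai p.1) (aj q.1) p.2 q.2).det := by
  rw [RingHom.map_det]
  congr 1
  ext p q
  simp [genMat]

open MvPolynomial in
lemma totalDegree_det_genMat {α r k : ℕ} {F : Type} [Field F]
    (B : Fin r → Fin k → Matrix (Fin α) (Fin α) F) {t : ℕ}
    (ai : Fin t → Fin r) (aj : Fin t → Fin k) :
    (genMat B ai aj).det.totalDegree ≤ t * α := by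
  rw [Matrix.det_apply]
  apply totalDegree_finsetSum_le
  intro σ _
  have h : (∏ i, genMat B ai aj (σ i) i).totalDegree ≤ t * α := by
    refine (totalDegree_finsetProd _ _).trans ?_
    refine (Finset.sum_le_card_nsmul _ _ 1 ?_).trans (by simp)
    intro i _
    refine (totalDegree_mul _ _).trans ?_
    simp
  rcases Int.units_eq_one_or (Equiv.Perm.sign σ) with h1 | h1
  · simpa [h1] using h
  · simpa [h1] using h

open MvPolynomial in
lemma det_genMat_ne_zero {α r k : ℕ} {F : Type} [Field F]
    (B : Fin r → Fin k → Matrix (Fin α) (Fin α) F) (hB : ∀ i j, IsUnit (B i j)) {t : ℕ}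
    (ai : Fin t → Fin r) (aj : Fin t → Fin k)
    (hi : Function.Injective ai) (hj : Function.Injective aj) :
    (genMat B ai aj).det ≠ 0 := by
  classical
  intro h0
  have h := eval_det_genMat B ai aj (fun p => if ∃ s, p = (ai s, aj s) then 1 else 0)
  rw [h0, map_zero] at h
  have h2 : (Matrix.of fun (p q : Fin t × Fin α) =>
      (if ∃ s, (ai p.1, aj q.1) = (ai s, aj s) then (1 : F) else 0) *
        B (ai p.1) (aj q.1) p.2 q.2) =
      (Matrix.blockDiagonal fun s => B (ai s) (aj s)).submatrix
        (Equiv.prodComm _ _) (Equiv.prodComm _ _) := by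
    ext ⟨s, a⟩ ⟨u, b⟩
    by_cases hsu : s = u
    · subst hsu
      have : ∃ s', (ai s, aj s) = (ai s', aj s') := ⟨s, rfl⟩
      simp only [Matrix.of_apply, if_pos this]
      simp [Matrix.blockDiagonal_apply]
    · have : ¬ ∃ s', (ai s, aj u) = (ai s', aj s') := by
        rintro ⟨s', hs⟩
        rw [Prod.mk.injEq] at hs
        exact hsu ((hi hs.1).trans (hj hs.2).symm)
      simp only [Matrix.of_apply, if_neg this]
      simp [Matrix.blockDiagonal_apply, hsu]
  rw [h2, Matrix.det_submatrix_equiv_self, Matrix.det_blockDiagonal] at h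
  refine (Finset.prod_ne_zero_iff.mpr ?_) h.symm
  intro s _
  exact ((Matrix.isUnit_iff_isUnit_det _).mp (hB _ _)).ne_zero


/-!
Lemma 5 of the paper: over a sufficiently large field, any parity generator
matrix whose `α × α` encoding blocks `B i j` (`i ∈ [r]`, `j ∈ [k]`) are all
invertible can be turned, by scaling each block by a suitable nonzero scalar
`lam i j`, into one in which every square sub-block matrix is invertible
(equivalently, by Lemma 4, into the parity part of a `[k+r, k]` MDS array
code).  "Field of size `> N`" is expressed via cardinality: `N < #F`.
-/
theorem stmt_7 (α r k : ℕ) (hα : 1 ≤ α) (hr : 1 ≤ r) (hk : 1 ≤ k) :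
    ∃ N : ℕ, 0 < N ∧
      ∀ (F : Type) [Field F], (N : Cardinal) < Cardinal.mk F →
        ∀ B : Fin r → Fin k → Matrix (Fin α) (Fin α) F,
          (∀ i j, IsUnit (B i j)) →
          ∃ lam : Fin r → Fin k → F,
            (∀ i j, lam i j ≠ 0) ∧
            ∀ t : ℕ, 1 ≤ t → ∀ (ai : Fin t → Fin r) (aj : Fin t → Fin k),
              Function.Injective ai → Function.Injective aj →
              IsUnit (Matrix.of fun (p q : Fin t × Fin α) =>
                lam (ai p.1) (aj q.1) * B (ai p.1) (aj q.1) p.2 q.2) := by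
  classical
  let σ := Σ t : Fin (r + 1), (Fin t.1 ↪ Fin r) × (Fin t.1 ↪ Fin k)
  refine ⟨1 + r * k + ∑ s : σ, s.1.1 * α, by omega, ?_⟩
  intro F _ hF B hB
  obtain ⟨S, hS⟩ := Cardinal.exists_finset_le_card F (1 + r * k + ∑ s : σ, s.1.1 * α) hF.le
  let P : MvPolynomial (Fin r × Fin k) F :=
    (∏ p : Fin r × Fin k, MvPolynomial.X p) * ∏ s : σ, (genMat B s.2.1 s.2.2).det
  have hP : P ≠ 0 := by
    refine mul_ne_zero (Finset.prod_ne_zero_iff.mpr fun p _ => MvPolynomial.X_ne_zero p)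
      (Finset.prod_ne_zero_iff.mpr fun s _ => ?_)
    exact det_genMat_ne_zero B hB _ _ s.2.1.injective s.2.2.injective
  have hdeg : P.totalDegree ≤ r * k + ∑ s : σ, s.1.1 * α := by
    refine (MvPolynomial.totalDegree_mul _ _).trans (add_le_add ?_ ?_)
    · exact (MvPolynomial.totalDegree_finsetProd _ _).trans (by simp)
    · exact (MvPolynomial.totalDegree_finsetProd _ _).trans
        (Finset.sum_le_sum fun s _ => totalDegree_det_genMat B _ _)
  have hex : ∃ x : Fin r × Fin k → F, MvPolynomial.eval x P ≠ 0 := by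
    by_contra! hcon
    refine hP (MvPolynomial.eq_zero_of_eval_zero_at_prod_finset P (fun _ => S) ?_
      fun x _ => hcon x)
    intro i
    have := MvPolynomial.degreeOf_le_totalDegree P i
    omega
  obtain ⟨x, hx⟩ := hex
  rw [map_mul, map_prod, map_prod] at hx
  have hx1 := Finset.prod_ne_zero_iff.mp (left_ne_zero_of_mul hx)
  have hx2 := Finset.prod_ne_zero_iff.mp (right_ne_zero_of_mul hx)
  refine ⟨fun i j => x (i, j), fun i j => ?_, ?_⟩
  · simpa using hx1 (i, j) (Finset.mem_univ _)
  · intro t _ ai aj hi hj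
    have ht : t < r + 1 := by
      have := Fintype.card_le_of_injective ai hi
      simp at this
      omega
    have := hx2 ⟨⟨t, ht⟩, ⟨ai, hi⟩, ⟨aj, hj⟩⟩ (Finset.mem_univ _)
    rw [eval_det_genMat] at this
    rw [Matrix.isUnit_iff_isUnit_det, isUnit_iff_ne_zero]
    exact this
end

section
/- Let F be a field and α a positive integer with |F| > α. If A, B, C, D are invertible α×α matrices over F, then there exists λ ∈ F such that the 2α×2α block matrix with blocks [[A, B], [C, λD]] is invertible. -/
/-!
If `A, B, C, D` are invertible `α × α` matrices over a field `F` with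
`|F| > α`, then there exists `λ ∈ F` such that the `2α × 2α` block matrix
`[[A, B], [C, λ • D]]` is invertible.  "`|F| > α`" is expressed via
cardinality: `α < #F`.
-/
theorem stmt_8 (F : Type*) [Field F] (α : ℕ) (hα : 1 ≤ α)
    (hcard : (α : Cardinal) < Cardinal.mk F)
    (A B C D : Matrix (Fin α) (Fin α) F)
    (hA : IsUnit A) (hB : IsUnit B) (hC : IsUnit C) (hD : IsUnit D) :
    ∃ lam : F, IsUnit (Matrix.fromBlocks A B C (lam • D)) := by
  obtain ⟨iA⟩ := hA.nonempty_invertible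
  obtain ⟨iD⟩ := hD.nonempty_invertible
  obtain ⟨r, hr⟩ := Polynomial.exists_eval_ne_zero_of_natDegree_lt_card
    (C * ⅟A * B * ⅟D).charpoly (Matrix.charpoly_monic _).ne_zero
    (by simpa [Matrix.charpoly_natDegree_eq_dim] using hcard)
  rw [Matrix.eval_charpoly] at hr
  refine ⟨r, ?_⟩
  have h : r • D - C * ⅟A * B = (Matrix.scalar (Fin α) r - C * ⅟A * B * ⅟D) * D := by
    rw [sub_mul, Matrix.mul_assoc _ (⅟D) D, invOf_mul_self, Matrix.mul_one,
      Matrix.scalar_apply, ← Matrix.smul_eq_diagonal_mul]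
  rw [Matrix.isUnit_iff_isUnit_det] at hA hD ⊢
  rw [Matrix.det_fromBlocks₁₁, h, Matrix.det_mul]
  exact hA.mul ((isUnit_iff_ne_zero.mpr hr).mul hD)
end

section
/- Let F be a field, let k ≥ 1, r ≥ 1 and 1 ≤ ρ ≤ r, set C = C(r,ρ) (the binomial coefficient) and α = ρ^{kC}, and index the standard basis (e_v) of F^α by functions v : [k] × S → Z/ρZ, where S is the set of ρ-element subsets of [r]. Fix f ∈ [k] and R ∈ S with elements d_1 < d_2 < … < d_ρ, and let Y_{f,R} = span{e_v : v(f,R) = 0}. Then for each t ∈ [ρ], the image of Y_{f,R} under the permutation matrix Q_{d_t, f} equals span{e_v : v(f,R) = t−1}. Consequently, the images of Y_{f,R} under Q_{d_1,f}, Q_{d_2,f}, …, Q_{d_ρ,f} form an independent family of subspaces whose sum is all of F^α. -/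
/-!
Signal-recovery claim in the proof of Lemma 6 (Construction 2).

The space `F^α` with `α = ρ^(k·C(r,ρ))` is realized as the function space
`Lbl k r ρ → F`, where the label space `Lbl k r ρ` consists of the functions
`v : Fin k × S → ZMod ρ` and `S = ParitySets r ρ` is the set of `ρ`-element
subsets of `Fin r`; the standard basis vector `e_v` is `Pi.single v 1`.

For `R ∈ S` with elements `d_1 < … < d_ρ` (so `d_t = R.orderIsoOfFin t`),
`ω_R(i) = t - 1` if `i = d_t` and `ω_R(i) = 0` for `i ∉ R`.  The permutation
matrix `Q_{i,j}` of the translation `v ↦ v + ∑_R ω_R(i) • e_{(j,R)}` is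
realized as the linear map sending `x` to `fun v => x (v - shift i j)`
(so `e_v` is sent to `e_{v + shift i j}`).
-/

namespace MSR

/-- `ρ`-element subsets of `[r]`. -/
abbrev ParitySets (r ρ : ℕ) := {R : Finset (Fin r) // R.card = ρ}

/-- The label space indexing the standard basis of `F^α`, `α = ρ^(k·C(r,ρ))`. -/
abbrev Lbl (k r ρ : ℕ) := (Fin k × ParitySets r ρ) → ZMod ρ

/-- `ω_R(i) = t - 1 ∈ ZMod ρ` if `i` is the `t`-th smallest element of `R`
(`1`-indexed), and `ω_R(i) = 0` if `i ∉ R`. -/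
noncomputable def omega (r ρ : ℕ) (R : ParitySets r ρ) (i : Fin r) : ZMod ρ :=
  if hi : i ∈ R.1 then ((((R.1.orderIsoOfFin R.2).symm ⟨i, hi⟩ : Fin ρ) : ℕ) : ZMod ρ)
  else 0

/-- The translation vector `∑_R ω_R(i) • e_{(j,R)}` of the label space. -/
noncomputable def shift (k r ρ : ℕ) (i : Fin r) (j : Fin k) : Lbl k r ρ :=
  fun p => if p.1 = j then omega r ρ p.2 i else 0

/-- The permutation matrix `Q_{i,j}`, as the linear map sending the basis
vector `e_v` to `e_{v + shift i j}`. -/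
noncomputable def Q (F : Type*) [Field F] (k r ρ : ℕ) (i : Fin r) (j : Fin k) :
    (Lbl k r ρ → F) →ₗ[F] (Lbl k r ρ → F) :=
  LinearMap.funLeft F F (fun v => v - shift k r ρ i j)

end MSR

open MSR

theorem stmt_9 (F : Type*) [Field F] (k r ρ : ℕ)
    (hk : 1 ≤ k) (hr : 1 ≤ r) (hρ1 : 1 ≤ ρ) (hρr : ρ ≤ r)
    (f : Fin k) (R : ParitySets r ρ)
    (Y : Submodule F (Lbl k r ρ → F))
    (hY : Y = Submodule.span F
      ((fun v => Pi.single v (1 : F)) '' {v : Lbl k r ρ | v (f, R) = 0})) :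
    -- the image of `Y_{f,R}` under `Q_{d_t, f}` is `span {e_v : v (f,R) = t - 1}`
    (∀ t : Fin ρ,
      Y.map (Q F k r ρ ((R.1.orderIsoOfFin R.2 t : Fin r)) f) =
        Submodule.span F ((fun v => Pi.single v (1 : F)) ''
          {v : Lbl k r ρ | v (f, R) = ((t : ℕ) : ZMod ρ)}))
    -- the images form an independent family of subspaces
    ∧ iSupIndep (fun t : Fin ρ =>
        Y.map (Q F k r ρ ((R.1.orderIsoOfFin R.2 t : Fin r)) f))
    -- whose sum is the whole space
    ∧ (⨆ t : Fin ρ,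
        Y.map (Q F k r ρ ((R.1.orderIsoOfFin R.2 t : Fin r)) f)) = ⊤ := by
  have hQ : ∀ t : Fin ρ,
      Y.map (Q F k r ρ ((R.1.orderIsoOfFin R.2 t : Fin r)) f) =
        Submodule.span F ((fun v => Pi.single v (1 : F)) ''
          {v : Lbl k r ρ | v (f, R) = ((t : ℕ) : ZMod ρ)}) := by
    intro t
    have hs : shift k r ρ ((R.1.orderIsoOfFin R.2 t : Fin r)) f (f, R) = ((t : ℕ) : ZMod ρ) := by
      simp only [shift, omega, if_true]
      rw [dif_pos (R.1.orderIsoOfFin R.2 t).2]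
      simp only [Subtype.coe_eta, OrderIso.symm_apply_apply]
    have hsingle : ∀ v : Lbl k r ρ,
        Q F k r ρ ((R.1.orderIsoOfFin R.2 t : Fin r)) f (Pi.single v (1 : F)) =
          Pi.single (v + shift k r ρ ((R.1.orderIsoOfFin R.2 t : Fin r)) f) (1 : F) := by
      intro v
      funext w
      simp only [Q, LinearMap.funLeft_apply, Pi.single_apply, sub_eq_iff_eq_add]
    rw [hY, Submodule.map_span, Set.image_image]
    congr 1
    ext x
    constructor
    · rintro ⟨v, hv, rfl⟩
      refine ⟨_, ?_, (hsingle v).symm⟩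
      have hv' : v (f, R) = 0 := hv
      simp only [Set.mem_setOf_eq, Pi.add_apply, hv', hs, zero_add]
    · rintro ⟨v, hv, rfl⟩
      have hv' : v (f, R) = ((t : ℕ) : ZMod ρ) := hv
      refine ⟨v - shift k r ρ ((R.1.orderIsoOfFin R.2 t : Fin r)) f, ?_, ?_⟩
      · simp only [Set.mem_setOf_eq, Pi.sub_apply, hv', hs, sub_self]
      · simp only [hsingle, sub_add_cancel]
  have hsupp : ∀ (A : Set (Lbl k r ρ)) (x : Lbl k r ρ → F),
      x ∈ Submodule.span F ((fun v => Pi.single v (1 : F)) '' A) → ∀ w, w ∉ A → x w = 0 := by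
    intro A x hx w hw
    induction hx using Submodule.span_induction with
    | mem x h =>
      obtain ⟨v, hv, rfl⟩ := h
      have hne : w ≠ v := fun h => hw (h ▸ hv)
      simp only [Pi.single_apply, if_neg hne]
    | zero => rfl
    | add x y _ _ hx hy => rw [Pi.add_apply, hx, hy, add_zero]
    | smul a x _ hx => rw [Pi.smul_apply, hx, smul_zero]
  refine ⟨hQ, ?_, ?_⟩
  · intro t
    simp only [hQ]
    rw [Submodule.disjoint_def]
    intro x hx hx'
    have hle : (⨆ (j : Fin ρ) (_ : j ≠ t), Submodule.span F
        ((fun v => Pi.single v (1 : F)) '' {v : Lbl k r ρ | v (f, R) = ((j : ℕ) : ZMod ρ)})) ≤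
        Submodule.span F ((fun v => Pi.single v (1 : F)) ''
          {v : Lbl k r ρ | v (f, R) ≠ ((t : ℕ) : ZMod ρ)}) := by
      refine iSup₂_le fun j hj => Submodule.span_mono (Set.image_mono ?_)
      intro v hv hv'
      have hv1 : v (f, R) = ((j : ℕ) : ZMod ρ) := hv
      have h2 : ((j : ℕ) : ZMod ρ) = ((t : ℕ) : ZMod ρ) := hv1.symm.trans hv'
      rw [ZMod.natCast_eq_natCast_iff', Nat.mod_eq_of_lt j.2, Nat.mod_eq_of_lt t.2] at h2
      exact hj (Fin.ext h2)
    funext w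
    by_cases hw : w (f, R) = ((t : ℕ) : ZMod ρ)
    · exact hsupp _ x (hle hx') w (fun h => h hw)
    · exact hsupp _ x hx w hw
  · simp only [hQ]
    haveI : NeZero ρ := ⟨by omega⟩
    rw [eq_top_iff]
    intro x _
    have hx : x = ∑ v, x v • (Pi.single v (1 : F) : Lbl k r ρ → F) := by
      funext w
      simp [Finset.sum_apply, Pi.single_apply]
    rw [hx]
    refine Submodule.sum_mem _ fun v _ => Submodule.smul_mem _ _ ?_
    refine Submodule.mem_iSup_of_mem (⟨(v (f, R)).val, ZMod.val_lt _⟩ : Fin ρ) ?_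
    refine Submodule.subset_span ⟨v, ?_, rfl⟩
    simp
end

section
/- Let F be a field, let k ≥ 1, r ≥ 1 and 1 ≤ ρ ≤ r, set C = C(r,ρ) (the binomial coefficient) and α = ρ^{kC}, and index the standard basis (e_v) of F^α by functions v : [k] × S → Z/ρZ, where S is the set of ρ-element subsets of [r]. Fix f ∈ [k] and R ∈ S, and let Y_{f,R} = span{e_v : v(f,R) = 0}. Then for every j ∈ [k] with j ≠ f and every i ∈ [r], the image of Y_{f,R} under the permutation matrix Q_{i,j} equals Y_{f,R} itself. -/
open MSR

theorem stmt_10 (F : Type*) [Field F] (k r ρ : ℕ)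
    (hk : 1 ≤ k) (hr : 1 ≤ r) (hρ1 : 1 ≤ ρ) (hρr : ρ ≤ r)
    (f : Fin k) (R : ParitySets r ρ)
    (Y : Submodule F (Lbl k r ρ → F))
    (hY : Y = Submodule.span F
      ((fun v => Pi.single v (1 : F)) '' {v : Lbl k r ρ | v (f, R) = 0})) :
    ∀ j : Fin k, j ≠ f → ∀ i : Fin r, Y.map (Q F k r ρ i j) = Y := by
  intro j hj i
  have hs : shift k r ρ i j (f, R) = 0 := by
    simp [shift, hj.symm]
  have hQ : ∀ v : Lbl k r ρ, Q F k r ρ i j (Pi.single v (1 : F))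
      = Pi.single (v + shift k r ρ i j) (1 : F) := by
    intro v
    funext w
    simp only [Q, LinearMap.funLeft_apply, Pi.single_apply, sub_eq_iff_eq_add]
  rw [hY, Submodule.map_span, Set.image_image]
  congr 1
  ext x
  simp only [Set.mem_image, Set.mem_setOf_eq, hQ]
  constructor
  · rintro ⟨v, hv, rfl⟩
    exact ⟨v + shift k r ρ i j, by rw [Pi.add_apply, hv, hs, add_zero], rfl⟩
  · rintro ⟨v, hv, rfl⟩
    exact ⟨v - shift k r ρ i j, by rw [Pi.sub_apply, hv, hs, sub_zero], by rw [sub_add_cancel]⟩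
end

section
/- Let F be a field, let k ≥ 1, r ≥ 1 and 1 ≤ ρ ≤ r, set n = k + r, C = C(r,ρ) and α = ρ^{kC}, and index the standard basis of F^α by functions v : [k] × S → Z/ρZ, where S is the set of ρ-element subsets of [r]. Let λ_{i,j} ∈ F be nonzero scalars and set A_{i,j} = λ_{i,j} Q_{i,j} for i ∈ [r], j ∈ [k]. Consider the [n,k] array code in which systematic node j stores x_j ∈ F^α and parity node k+i stores Σ_{j=1}^k A_{i,j} x_j. Then for every failed systematic node f ∈ [k] and every R ∈ S, the vector x_f is determined by the coordinates indexed by Y_{f,R} = {v : v(f,R) = 0} of the contents of the helper nodes consisting of all systematic nodes j ≠ f and the parity nodes k+i with i ∈ R; that is, if two data arrays agree in all coordinates v ∈ Y_{f,R} of x_j for every j ∈ [k] \ {f} and of Σ_j A_{i,j}x_j for every i ∈ R, then their f-th data vectors are equal. Hence node f can be repaired by downloading α/ρ symbols from each of the d = (k−1)+ρ helper nodes, which is the optimal repair bandwidth. -/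
open MSR

theorem stmt_11 (F : Type*) [Field F] (k r ρ : ℕ)
    (hk : 1 ≤ k) (hr : 1 ≤ r) (hρ1 : 1 ≤ ρ) (hρr : ρ ≤ r)
    (lam : Fin r → Fin k → F) (hlam : ∀ i j, lam i j ≠ 0)
    (f : Fin k) (R : ParitySets r ρ)
    (x x' : Fin k → Lbl k r ρ → F)
    (hsys : ∀ j : Fin k, j ≠ f →
      ∀ v : Lbl k r ρ, v (f, R) = 0 → x j v = x' j v)
    (hpar : ∀ i : Fin r, i ∈ R.1 →
      ∀ v : Lbl k r ρ, v (f, R) = 0 →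
        ∑ j : Fin k, lam i j * x j (v - shift k r ρ i j) =
        ∑ j : Fin k, lam i j * x' j (v - shift k r ρ i j)) :
    x f = x' f := by
  have : NeZero ρ := ⟨by omega⟩
  funext w
  obtain ⟨i, hi, hw⟩ : ∃ i ∈ R.1, omega r ρ R i = - w (f, R) := by
    let t : Fin ρ := ⟨(- w (f, R)).val, ZMod.val_lt _⟩
    refine ⟨(R.1.orderIsoOfFin R.2 t).1, (R.1.orderIsoOfFin R.2 t).2, ?_⟩
    unfold omega
    rw [dif_pos (R.1.orderIsoOfFin R.2 t).2]
    simp only [Subtype.coe_eta, OrderIso.symm_apply_apply]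
    exact ZMod.natCast_zmod_val _
  have hv : (w + shift k r ρ i f) (f, R) = 0 := by
    simp [shift, hw]
  have h := hpar i hi (w + shift k r ρ i f) hv
  rw [← Finset.add_sum_erase _ _ (Finset.mem_univ f),
    ← Finset.add_sum_erase _ (fun j => lam i j * x' j _) (Finset.mem_univ f)] at h
  have he : ∑ j ∈ Finset.univ.erase f,
        lam i j * x j (w + shift k r ρ i f - shift k r ρ i j) =
      ∑ j ∈ Finset.univ.erase f,
        lam i j * x' j (w + shift k r ρ i f - shift k r ρ i j) := by
    refine Finset.sum_congr rfl fun j hj => ?_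
    have hjf : j ≠ f := Finset.ne_of_mem_erase hj
    rw [hsys j hjf]
    rw [Pi.sub_apply, hv]
    simp [shift, hjf.symm]
  rw [he] at h
  have h2 := mul_left_cancel₀ (hlam i f) (add_right_cancel h)
  simpa using h2
end

section
/- Let k ≥ 1, r ≥ 1 and 1 ≤ ρ ≤ r, set n = k + r, C = C(r,ρ) and α = ρ^{kC}. There exists a positive integer N = N(k, r, ρ) with the following property: for every field F with |F| > N there exist nonzero scalars λ_{i,j} ∈ F (i ∈ [r], j ∈ [k]) such that the [n,k] array code with encoding matrices A_{i,j} = λ_{i,j} Q_{i,j} (systematic node j stores x_j ∈ F^α, parity node k+i stores Σ_{j=1}^k A_{i,j}x_j) satisfies both: (MDS) for every subset K ⊆ [n] with |K| = k, the data (x_1,…,x_k) is uniquely determined by the contents of the nodes indexed by K; and (optimal systematic repair) for every f ∈ [k] and every R ∈ S, the vector x_f is determined by the coordinates indexed by {v : v(f,R) = 0} of the contents of the helper nodes consisting of all systematic nodes j ≠ f and the parity nodes k+i with i ∈ R (a download of α/ρ symbols from each of d = (k−1)+ρ helpers). -/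
namespace MSR

/-- The content of the nodes of the array code of Construction 2:
systematic node `Sum.inl j` stores `x j`, parity node `Sum.inr i` stores
`∑ j, lam i j • Q_{i,j} (x j)`. -/
noncomputable def content (F : Type*) [Field F] (k r ρ : ℕ)
    (lam : Fin r → Fin k → F) (x : Fin k → Lbl k r ρ → F) :
    (Fin k ⊕ Fin r) → Lbl k r ρ → F
  | Sum.inl j => x j
  | Sum.inr i => fun v => ∑ j : Fin k, lam i j * x j (v - shift k r ρ i j)

end MSR

namespace MSR

open Classical in
/-- Entries of the generator matrix. -/
noncomputable def entry {A : Type*} [CommRing A] (k r ρ : ℕ) (lam : Fin r → Fin k → A) :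
    (Fin k ⊕ Fin r) → Lbl k r ρ → Fin k × Lbl k r ρ → A
  | Sum.inl j', v, p => if p = (j', v) then 1 else 0
  | Sum.inr i, v, p => if p.2 = v - shift k r ρ i p.1 then lam i p.1 else 0

/-- The square matrix of the `k` nodes `e a`. -/
noncomputable def nodeMat {A : Type*} [CommRing A] (k r ρ : ℕ) (lam : Fin r → Fin k → A)
    (e : Fin k → Fin k ⊕ Fin r) : Matrix (Fin k × Lbl k r ρ) (Fin k × Lbl k r ρ) A :=
  fun q p => entry k r ρ lam (e q.1) q.2 p

lemma entry_sum {F : Type*} [Field F] (k r ρ : ℕ) [NeZero ρ] (lam : Fin r → Fin k → F)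
    (m : Fin k ⊕ Fin r) (v : Lbl k r ρ) (y : Fin k × Lbl k r ρ → F) :
    ∑ p, entry k r ρ lam m v p * y p = content F k r ρ lam (fun j w => y (j, w)) m v := by
  classical
  cases m with
  | inl j' => simp [entry, content]
  | inr i => simp [entry, content, Fintype.sum_prod_type]

lemma nodeMat_mulVec {F : Type*} [Field F] (k r ρ : ℕ) [NeZero ρ] (lam : Fin r → Fin k → F)
    (e : Fin k → Fin k ⊕ Fin r) (y : Fin k × Lbl k r ρ → F) (q : Fin k × Lbl k r ρ) :
    (nodeMat k r ρ lam e).mulVec y q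
      = content F k r ρ lam (fun j w => y (j, w)) (e q.1) q.2 :=
  entry_sum k r ρ lam (e q.1) q.2 y

lemma nodeMat_map {A B : Type*} [CommRing A] [CommRing B] (φ : A →+* B) (k r ρ : ℕ) [NeZero ρ]
    (lam : Fin r → Fin k → A) (e : Fin k → Fin k ⊕ Fin r) :
    φ.mapMatrix (nodeMat k r ρ lam e) = nodeMat k r ρ (fun i j => φ (lam i j)) e := by
  ext q p
  simp only [RingHom.mapMatrix_apply, Matrix.map_apply, nodeMat]
  cases e q.1 <;> simp only [entry] <;> split_ifs <;> simp

/-- The nodes in `K`, enumerated. -/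
noncomputable def enum (k r : ℕ) (K : {K : Finset (Fin k ⊕ Fin r) // K.card = k}) :
    Fin k → Fin k ⊕ Fin r :=
  fun a => ((K.1.equivFinOfCardEq K.2).symm a).1

lemma enum_surj (k r : ℕ) (K : {K : Finset (Fin k ⊕ Fin r) // K.card = k}) (m : Fin k ⊕ Fin r)
    (hm : m ∈ K.1) : ∃ a, enum k r K a = m :=
  ⟨K.1.equivFinOfCardEq K.2 ⟨m, hm⟩, by simp [enum]⟩

lemma enum_mem (k r : ℕ) (K : {K : Finset (Fin k ⊕ Fin r) // K.card = k}) (a : Fin k) :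
    enum k r K a ∈ K.1 := ((K.1.equivFinOfCardEq K.2).symm a).2

/-- A matching of the missing systematic nodes into the chosen parity nodes. -/
lemma exists_match (k r : ℕ) (K : Finset (Fin k ⊕ Fin r)) (hK : K.card = k) (hr : 1 ≤ r) :
    ∃ g : Fin k → Fin r, (∀ j, Sum.inl j ∉ K → Sum.inr (g j) ∈ K) ∧
      ∀ j j', Sum.inl j ∉ K → Sum.inl j' ∉ K → g j = g j' → j = j' := by
  classical
  have h1 : K.toLeft.card + K.toRight.card = K.card := Finset.card_toLeft_add_card_toRight
  have h2 : (K.toLeftᶜ).card = K.toRight.card := by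
    rw [Finset.card_compl, Fintype.card_fin]; omega
  let e := Finset.equivOfCardEq h2
  refine ⟨fun j => if h : j ∈ K.toLeftᶜ then (e ⟨j, h⟩).1 else ⟨0, hr⟩, ?_, ?_⟩
  · intro j hj
    have h : j ∈ K.toLeftᶜ := by simpa using hj
    simp only [h, dif_pos]
    exact Finset.mem_toRight.1 (e ⟨j, h⟩).2
  · intro j j' hj hj' he
    have h : j ∈ K.toLeftᶜ := by simpa using hj
    have h' : j' ∈ K.toLeftᶜ := by simpa using hj'
    simp only [h, h', dif_pos] at he
    have := e.injective (Subtype.ext he)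
    simpa using this

/-- The MDS determinant polynomial over the integers. -/
noncomputable def detPoly (k r ρ : ℕ) [NeZero ρ]
    (K : {K : Finset (Fin k ⊕ Fin r) // K.card = k}) : MvPolynomial (Fin r × Fin k) ℤ :=
  open Classical in
  (nodeMat k r ρ (fun i j => (MvPolynomial.X (i, j) : MvPolynomial (Fin r × Fin k) ℤ))
    (enum k r K)).det

lemma detPoly_eval (F : Type*) [Field F] (k r ρ : ℕ) [NeZero ρ]
    (K : {K : Finset (Fin k ⊕ Fin r) // K.card = k}) (a : Fin r × Fin k → F) :
    MvPolynomial.eval a (MvPolynomial.map (Int.castRingHom F) (detPoly k r ρ K)) =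
      open Classical in (nodeMat k r ρ (fun i j => a (i, j)) (enum k r K)).det := by
  classical
  rw [detPoly, RingHom.map_det, RingHom.map_det, nodeMat_map, nodeMat_map]
  simp

lemma detPoly_ne_zero (F : Type*) [Field F] (k r ρ : ℕ) [NeZero ρ] (hr : 1 ≤ r)
    (K : {K : Finset (Fin k ⊕ Fin r) // K.card = k}) :
    MvPolynomial.map (Int.castRingHom F) (detPoly k r ρ K) ≠ 0 := by
  classical
  obtain ⟨g, hg1, hg2⟩ := exists_match k r K.1 K.2 hr
  intro h0
  have h := detPoly_eval F k r ρ K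
    (fun p => if Sum.inl p.2 ∉ K.1 ∧ g p.2 = p.1 then 1 else 0)
  rw [h0, map_zero] at h
  obtain ⟨y, hy, hy0⟩ := Matrix.exists_mulVec_eq_zero_iff.2 h.symm
  apply hy
  have key : ∀ m ∈ K.1, ∀ v, content F k r ρ
      (fun i j => if Sum.inl j ∉ K.1 ∧ g j = i then 1 else 0) (fun j w => y (j, w)) m v = 0 := by
    intro m hm v
    obtain ⟨a, rfl⟩ := enum_surj k r K m hm
    have := congrFun hy0 (a, v)
    rw [nodeMat_mulVec] at this
    simpa using this
  funext ⟨j, w⟩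
  by_cases hj : Sum.inl j ∈ K.1
  · exact key _ hj w
  · have := key _ (hg1 j hj) (w + shift k r ρ (g j) j)
    simp only [content] at this
    rw [Finset.sum_eq_single j] at this
    · simpa [hj] using this
    · intro j' _ hne
      rw [if_neg, zero_mul]
      rintro ⟨h1, h2⟩
      exact hne (hg2 _ _ h1 hj h2)
    · simp

/-- The total polynomial. -/
noncomputable def bigPoly (k r ρ : ℕ) [NeZero ρ] : MvPolynomial (Fin r × Fin k) ℤ :=
  (∏ K, detPoly k r ρ K) * ∏ p, MvPolynomial.X p

lemma omega_surj (r ρ : ℕ) [NeZero ρ] (R : ParitySets r ρ) (z : ZMod ρ) :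
    ∃ i ∈ R.1, omega r ρ R i = z := by
  let t : Fin ρ := ⟨z.val, ZMod.val_lt z⟩
  refine ⟨(R.1.orderIsoOfFin R.2 t).1, (R.1.orderIsoOfFin R.2 t).2, ?_⟩
  rw [omega, dif_pos (R.1.orderIsoOfFin R.2 t).2]
  have h : (R.1.orderIsoOfFin R.2).symm ⟨(R.1.orderIsoOfFin R.2 t).1, (R.1.orderIsoOfFin R.2 t).2⟩
      = t := (R.1.orderIsoOfFin R.2).symm_apply_apply t
  rw [h]
  simp [t]

end MSR

open MSR

theorem stmt_12 (k r ρ : ℕ) (hk : 1 ≤ k) (hr : 1 ≤ r) (hρ1 : 1 ≤ ρ) (hρr : ρ ≤ r) :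
    ∃ N : ℕ, 0 < N ∧
      ∀ (F : Type) [Field F], (N : Cardinal) < Cardinal.mk F →
        ∃ lam : Fin r → Fin k → F,
          (∀ i j, lam i j ≠ 0) ∧
          -- (MDS): any `k` nodes determine the data
          (∀ K : Finset (Fin k ⊕ Fin r), K.card = k →
            ∀ x x' : Fin k → Lbl k r ρ → F,
              (∀ m ∈ K, content F k r ρ lam x m = content F k r ρ lam x' m) →
              x = x') ∧
          -- (optimal systematic repair): for every failed systematic node `f`
          -- and every `ρ`-subset `R` of the parity nodes, `x f` is determined
          -- by the coordinates in `{v : v (f,R) = 0}` of the contents of the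
          -- helper nodes (all systematic `j ≠ f` and the parities `k+i`,
          -- `i ∈ R`) — a download of `α/ρ` symbols from each of the
          -- `d = (k-1) + ρ` helpers
          (∀ (f : Fin k) (R : ParitySets r ρ),
            ∀ x x' : Fin k → Lbl k r ρ → F,
              (∀ j : Fin k, j ≠ f → ∀ v : Lbl k r ρ, v (f, R) = 0 →
                content F k r ρ lam x (Sum.inl j) v =
                content F k r ρ lam x' (Sum.inl j) v) →
              (∀ i : Fin r, i ∈ R.1 → ∀ v : Lbl k r ρ, v (f, R) = 0 →
                content F k r ρ lam x (Sum.inr i) v =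
                content F k r ρ lam x' (Sum.inr i) v) →
              x f = x' f) := by
  classical
  haveI : NeZero ρ := ⟨by omega⟩
  refine ⟨(bigPoly k r ρ).totalDegree + 1, Nat.succ_pos _, ?_⟩
  intro F _ hF
  obtain ⟨S, hS⟩ := Cardinal.exists_finset_le_card F _ hF.le
  have hne : MvPolynomial.map (Int.castRingHom F) (bigPoly k r ρ) ≠ 0 := by
    rw [bigPoly, map_mul, map_prod, map_prod]
    refine mul_ne_zero (Finset.prod_ne_zero_iff.2 fun K _ => detPoly_ne_zero F k r ρ hr K)
      (Finset.prod_ne_zero_iff.2 fun p _ => ?_)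
    simp
  have hex : ∃ a : Fin r × Fin k → F,
      MvPolynomial.eval a (MvPolynomial.map (Int.castRingHom F) (bigPoly k r ρ)) ≠ 0 := by
    by_contra! hcon
    refine hne (MvPolynomial.eq_zero_of_eval_zero_at_prod_finset _ (fun _ => S) ?_
      fun x _ => hcon x)
    intro p
    have h1 := MvPolynomial.degreeOf_le_totalDegree
      (MvPolynomial.map (Int.castRingHom F) (bigPoly k r ρ)) p
    have h2 : (MvPolynomial.map (Int.castRingHom F) (bigPoly k r ρ)).totalDegree
        ≤ (bigPoly k r ρ).totalDegree :=
      Finset.sup_mono (MvPolynomial.support_map_subset _ _)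
    omega
  obtain ⟨a, ha⟩ := hex
  rw [bigPoly, map_mul, map_prod, map_prod, map_mul, map_prod, map_prod] at ha
  have ha1 := Finset.prod_ne_zero_iff.1 (left_ne_zero_of_mul ha)
  have ha2 := Finset.prod_ne_zero_iff.1 (right_ne_zero_of_mul ha)
  have hlam : ∀ i j, a (i, j) ≠ 0 := fun i j => by
    simpa using ha2 (i, j) (Finset.mem_univ _)
  refine ⟨fun i j => a (i, j), hlam, ?_, ?_⟩
  · intro K hK x x' hx
    have hd := ha1 ⟨K, hK⟩ (Finset.mem_univ _)
    rw [detPoly_eval] at hd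
    have hz : (nodeMat k r ρ (fun i j => a (i, j)) (enum k r ⟨K, hK⟩)).mulVec
        ((fun p => x p.1 p.2) - fun p => x' p.1 p.2) = 0 := by
      rw [Matrix.mulVec_sub, sub_eq_zero]
      funext q
      rw [nodeMat_mulVec, nodeMat_mulVec]
      exact congrFun (hx _ (enum_mem k r ⟨K, hK⟩ q.1)) q.2
    have := Matrix.eq_zero_of_mulVec_eq_zero hd hz
    funext j w
    exact sub_eq_zero.1 (congrFun this (j, w))
  · intro f R x x' hsys hpar
    funext w
    obtain ⟨i, hi, hw⟩ := omega_surj r ρ R (-w (f, R))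
    have hv : (w + shift k r ρ i f) (f, R) = 0 := by simp [shift, hw]
    have h := hpar i hi _ hv
    simp only [content] at h
    rw [← Finset.add_sum_erase _ _ (Finset.mem_univ f),
      ← Finset.add_sum_erase _ _ (Finset.mem_univ f)] at h
    have hs : ∀ j ∈ Finset.univ.erase f,
        a (i, j) * x j (w + shift k r ρ i f - shift k r ρ i j)
          = a (i, j) * x' j (w + shift k r ρ i f - shift k r ρ i j) := by
      intro j hj
      have hjf := Finset.ne_of_mem_erase hj
      have := hsys j hjf (w + shift k r ρ i f - shift k r ρ i j) (by
        rw [Pi.sub_apply, hv]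
        simp [shift, hjf.symm])
      simp only [content] at this
      rw [this]
    rw [Finset.sum_congr rfl hs] at h
    have h' := mul_left_cancel₀ (hlam i f) (add_right_cancel h)
    simpa using h'
end

section
/- Let k ≥ 1, r ≥ 1 and k+1 ≤ d ≤ n−1 where n = k + r; set ρ = d − k + 1, C = C(r,ρ) and α = ρ^{kC}. There exists a positive integer N = N(k, r, d) with the following property: for every field F with |F| > N there exist nonzero scalars λ_{i,j} ∈ F (i ∈ [r], j ∈ [k]) such that the [n,k] array code with encoding matrices A_{i,j} = λ_{i,j} Q_{i,j} (systematic node j stores x_j ∈ F^α, parity node k+i stores Σ_{j=1}^k A_{i,j}x_j) satisfies both: (MDS) for every subset K ⊆ [n] with |K| = k, the data (x_1,…,x_k) is uniquely determined by the contents of the nodes indexed by K; and (optimal systematic repair from any helper set) for every failed systematic node f ∈ [k] and every subset D ⊆ [n] \ {f} with |D| = d, there exist matrices S_j ∈ F^{(α/ρ)×α} for j ∈ D such that x_f is determined by the repair data {S_j · (content of node j) : j ∈ D}, i.e., any two data arrays producing equal values of all these linear functions have equal f-th data vectors. In particular, for all admissible parameters n, k, d there exists an [n,k,d] systematic-repair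 MSR code over a sufficiently large finite field, in which any failed systematic node can be repaired from an arbitrary set of d helper nodes by downloading α/(d−k+1) symbols from each helper. -/
open MSR

namespace MSRAux

/-- Finitely many integer polynomials, each taking the value `1` somewhere, have a common
non-root over every sufficiently large field. -/
theorem exists_common_nonroot {σ T : Type} [Fintype σ] [Fintype T]
    (p : T → MvPolynomial σ ℤ) (a : T → σ → ℤ) (ha : ∀ t, MvPolynomial.eval (a t) (p t) = 1) :
    ∃ N : ℕ, 0 < N ∧ ∀ (F : Type) [Field F], (N : Cardinal) < Cardinal.mk F →
      ∃ x : σ → F, ∀ t, MvPolynomial.aeval x (p t) ≠ 0 := by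
  classical
  refine ⟨(∏ t, p t).totalDegree + 1, Nat.succ_pos _, ?_⟩
  intro F _ hF
  obtain ⟨s, hs⟩ := Cardinal.exists_finset_le_card F _ hF.le
  by_contra hcon
  push Not at hcon
  have h0 : MvPolynomial.map (Int.castRingHom F) (∏ t, p t) = 0 := by
    apply MvPolynomial.eq_zero_of_eval_zero_at_prod_finset _ (fun _ => s)
    · intro i
      have h1 : (MvPolynomial.map (Int.castRingHom F) (∏ t, p t)).degreeOf i
          ≤ (∏ t, p t).degreeOf i := by
        rw [MvPolynomial.degreeOf_le_iff]
        intro m hm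
        exact MvPolynomial.monomial_le_degreeOf i (MvPolynomial.support_map_subset _ _ hm)
      have h2 := MvPolynomial.degreeOf_le_totalDegree (∏ t, p t) i
      omega
    · intro x _
      obtain ⟨t, ht⟩ := hcon x
      rw [map_prod, map_prod]
      apply Finset.prod_eq_zero (Finset.mem_univ t)
      rw [MvPolynomial.eval_map]
      exact ht
  rw [map_prod, Finset.prod_eq_zero_iff] at h0
  obtain ⟨t, -, ht⟩ := h0
  have h3 : MvPolynomial.eval (fun i => Int.castRingHom F (a t i))
      (MvPolynomial.map (Int.castRingHom F) (p t)) = 1 := by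
    have := MvPolynomial.map_eval (Int.castRingHom F) (a t) (p t)
    rw [ha, map_one] at this
    exact this.symm
  rw [ht, map_zero] at h3
  exact zero_ne_one h3

/-- The matrix of the linear system selected by `g`. -/
noncomputable def genMat {A : Type*} [CommRing A] (k r ρ : ℕ) (lam : Fin r → Fin k → A)
    (g : Fin k × Lbl k r ρ → Option (Fin r)) :
    Matrix (Fin k × Lbl k r ρ) (Fin k × Lbl k r ρ) A :=
  Matrix.of fun p q => match g p with
    | none => if q = p then 1 else 0
    | some i => if q.2 = p.2 + shift k r ρ i p.1 - shift k r ρ i q.1 then lam i q.1 else 0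

theorem genMat_map {A B : Type*} [CommRing A] [CommRing B] (φ : A →+* B) (k r ρ : ℕ)
    (lam : Fin r → Fin k → A) (g : Fin k × Lbl k r ρ → Option (Fin r)) :
    (genMat k r ρ lam g).map φ = genMat k r ρ (fun i j => φ (lam i j)) g := by
  ext p q
  simp only [genMat, Matrix.map_apply, Matrix.of_apply]
  cases g p <;> simp only <;> split_ifs <;> simp

/-- Key lemma: generic solvability of all admissible systems. -/
theorem exists_lam (k r ρ : ℕ) [NeZero ρ] :
    ∃ N : ℕ, 0 < N ∧ ∀ (F : Type) [Field F], (N : Cardinal) < Cardinal.mk F →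
      ∃ lam : Fin r → Fin k → F, (∀ i j, lam i j ≠ 0) ∧
        ∀ g : Fin k × Lbl k r ρ → Option (Fin r),
          (∀ p q i, g p = some i → g q = some i → p.1 = q.1) →
          ∀ y : Fin k → Lbl k r ρ → F,
            (∀ j v, g (j, v) = none → y j v = 0) →
            (∀ j v i, g (j, v) = some i →
              ∑ j', lam i j' * y j' (v + shift k r ρ i j - shift k r ρ i j') = 0) →
            y = 0 := by
  classical
  let G := {g : Fin k × Lbl k r ρ → Option (Fin r) //
    ∀ p q i, g p = some i → g q = some i → p.1 = q.1}
  have : Finite G := Subtype.finite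
  let _ : Fintype G := Fintype.ofFinite G
  let L : Fin r → Fin k → MvPolynomial (Fin r × Fin k) ℤ := fun i j => MvPolynomial.X (i, j)
  obtain ⟨N, hN, h⟩ := exists_common_nonroot (σ := Fin r × Fin k) (T := G ⊕ (Fin r × Fin k))
    (Sum.elim (fun g => (genMat k r ρ L g.1).det) MvPolynomial.X)
    (Sum.elim (fun g s => if ∃ p, g.1 p = some s.1 ∧ p.1 = s.2 then 1 else 0) (fun _ _ => 1)) (by
      rintro (g | s)
      · simp only [Sum.elim_inl]
        rw [RingHom.map_det, RingHom.mapMatrix_apply, genMat_map]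
        rw [← Matrix.det_one (n := Fin k × Lbl k r ρ)]
        congr 1
        ext p q
        simp only [genMat, Matrix.of_apply, Matrix.one_apply, L, MvPolynomial.eval_X]
        cases hg : g.1 p with
        | none => simp [eq_comm]
        | some i =>
          simp only
          have hiff : (∃ p', g.1 p' = some i ∧ p'.1 = q.1) ↔ p.1 = q.1 := by
            constructor
            · rintro ⟨p', h1, h2⟩
              rw [← h2]; exact g.2 _ _ _ hg h1
            · intro h; exact ⟨p, hg, h⟩
          simp only [hiff]
          rcases p with ⟨j, v⟩
          rcases q with ⟨j', w⟩
          by_cases hj : j = j'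
          · subst hj
            simp [eq_comm]
          · simp [hj]
      · simp)
  refine ⟨N, hN, fun F _ hF => ?_⟩
  obtain ⟨x, hx⟩ := h F hF
  refine ⟨fun i j => x (i, j), ?_, ?_⟩
  · intro i j
    have := hx (Sum.inr (i, j))
    simpa using this
  · intro g hg y h1 h2
    have hdet := hx (Sum.inl ⟨g, hg⟩)
    simp only [Sum.elim_inl] at hdet
    rw [← AlgHom.coe_toRingHom, RingHom.map_det, RingHom.mapMatrix_apply, genMat_map] at hdet
    have hz := Matrix.eq_zero_of_mulVec_eq_zero hdet (v := fun q => y q.1 q.2) (by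
      ext ⟨j, v⟩
      simp only [Matrix.mulVec, dotProduct, genMat, Matrix.of_apply, L, Pi.zero_apply]
      cases hgp : g (j, v) with
      | none => simp [h1 j v hgp]
      | some i =>
        have := h2 j v i hgp
        simp only [Fintype.sum_prod_type]
        simpa using this)
    funext j v
    exact congrFun hz (j, v)

theorem exists_partial_inj {α β : Type} (M : Finset α) (N : Finset β) (h : M.card ≤ N.card) :
    ∃ e : α → Option β, (∀ a, a ∉ M → e a = none) ∧ (∀ a ∈ M, ∃ b ∈ N, e a = some b) ∧
      (∀ a b, e a = some b → b ∈ N) ∧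
      ∀ a a' b, e a = some b → e a' = some b → a = a' := by
  classical
  obtain ⟨φ⟩ := Function.Embedding.nonempty_of_card_le (α := M) (β := N) (by simpa using h)
  refine ⟨fun a => if ha : a ∈ M then some (φ ⟨a, ha⟩).1 else none, ?_, ?_, ?_, ?_⟩
  · intro a ha; simp [ha]
  · intro a ha; exact ⟨(φ ⟨a, ha⟩).1, (φ ⟨a, ha⟩).2, by simp [ha]⟩
  · intro a b hb
    by_cases ha : a ∈ M
    · simp only [ha, dif_pos, Option.some.injEq] at hb
      rw [← hb]; exact (φ ⟨a, ha⟩).2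
    · simp [ha] at hb
  · intro a a' b hb hb'
    by_cases ha : a ∈ M
    · by_cases ha' : a' ∈ M
      · simp only [ha, ha', dif_pos, Option.some.injEq] at hb hb'
        have := φ.injective (Subtype.ext (hb.trans hb'.symm))
        exact congrArg Subtype.val this
      · simp [ha'] at hb'
    · simp [ha] at hb

theorem omega_surj (r ρ : ℕ) [NeZero ρ] (R : ParitySets r ρ) (z : ZMod ρ) :
    ∃ i ∈ R.1, omega r ρ R i = z := by
  let t : Fin ρ := ⟨z.val, ZMod.val_lt z⟩
  refine ⟨(R.1.orderIsoOfFin R.2 t).1, (R.1.orderIsoOfFin R.2 t).2, ?_⟩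
  unfold omega
  rw [dif_pos (R.1.orderIsoOfFin R.2 t).2]
  have h : (R.1.orderIsoOfFin R.2).symm ⟨(R.1.orderIsoOfFin R.2 t).1,
      (R.1.orderIsoOfFin R.2 t).2⟩ = t := (R.1.orderIsoOfFin R.2).symm_apply_apply t
  rw [h]
  exact ZMod.natCast_zmod_val z

theorem exists_enum (k r ρ : ℕ) (hρ : 2 ≤ ρ) (p : Fin k × ParitySets r ρ) :
    ∃ e : Fin (ρ ^ (k * Nat.choose r ρ) / ρ) → Lbl k r ρ,
      ∀ v : Lbl k r ρ, v p = 0 → ∃ t, e t = v := by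
  classical
  have : NeZero ρ := ⟨by omega⟩
  have hcard : Fintype.card ({q // q ≠ p} → ZMod ρ) = ρ ^ (k * Nat.choose r ρ) / ρ := by
    have hc : Fintype.card (Fin k × ParitySets r ρ) = k * Nat.choose r ρ := by
      rw [Fintype.card_prod, Fintype.card_finset_len]; simp
    have hpos : 0 < k * Nat.choose r ρ := by
      rw [← hc]; exact Fintype.card_pos_iff.mpr ⟨p⟩
    rw [Fintype.card_fun, ZMod.card, Fintype.card_subtype_compl, hc]
    simp only [Fintype.card_unique]
    obtain ⟨m, hm⟩ : ∃ m, k * Nat.choose r ρ = m + 1 := ⟨_, (Nat.succ_pred_eq_of_pos hpos).symm⟩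
    rw [hm, pow_succ, Nat.mul_div_cancel _ (by omega)]
    simp
  let E := (Fintype.equivFinOfCardEq hcard).symm
  refine ⟨fun t q => if h : q = p then 0 else E t ⟨q, h⟩, fun v hv =>
    ⟨E.symm (fun q => v q.1), ?_⟩⟩
  funext q
  by_cases h : q = p
  · subst h; simp [hv]
  · simp [h]

theorem content_sub (F : Type*) [Field F] (k r ρ : ℕ)
    (lam : Fin r → Fin k → F) (x x' : Fin k → Lbl k r ρ → F) (m : Fin k ⊕ Fin r) :
    content F k r ρ lam (x - x') m = content F k r ρ lam x m - content F k r ρ lam x' m := by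
  cases m with
  | inl j => rfl
  | inr i =>
    funext v
    simp [content, mul_sub, Finset.sum_sub_distrib]

end MSRAux

theorem stmt_13 (k r d ρ : ℕ) (hk : 1 ≤ k) (hr : 1 ≤ r)
    (hd1 : k + 1 ≤ d) (hd2 : d ≤ k + r - 1) (hρ : ρ = d - k + 1) :
    ∃ N : ℕ, 0 < N ∧
      ∀ (F : Type) [Field F], (N : Cardinal) < Cardinal.mk F →
        ∃ lam : Fin r → Fin k → F,
          (∀ i j, lam i j ≠ 0) ∧
          -- (MDS): any `k` nodes determine the data
          (∀ K : Finset (Fin k ⊕ Fin r), K.card = k →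
            ∀ x x' : Fin k → Lbl k r ρ → F,
              (∀ m ∈ K, content F k r ρ lam x m = content F k r ρ lam x' m) →
              x = x') ∧
          -- (optimal systematic repair from any helper set): for every failed
          -- systematic node `f` and every set `D` of `d` helper nodes not
          -- containing `f`, there are repair maps `S m : F^α →ₗ F^(α/ρ)` such
          -- that `x f` is determined by the repair data
          -- `{S m (content of node m) : m ∈ D}`
          (∀ (f : Fin k) (D : Finset (Fin k ⊕ Fin r)),
            Sum.inl f ∉ D → D.card = d →
            ∃ S : (Fin k ⊕ Fin r) →
                ((Lbl k r ρ → F) →ₗ[F] (Fin (ρ ^ (k * Nat.choose r ρ) / ρ) → F)),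
              ∀ x x' : Fin k → Lbl k r ρ → F,
                (∀ m ∈ D, S m (content F k r ρ lam x m) =
                          S m (content F k r ρ lam x' m)) →
                x f = x' f) := by
  classical
  have hρ2 : 2 ≤ ρ := by omega
  have : NeZero ρ := ⟨by omega⟩
  obtain ⟨N, hN, H⟩ := MSRAux.exists_lam k r ρ
  refine ⟨N, hN, fun F _ hF => ?_⟩
  obtain ⟨lam, hlam, hgen⟩ := H F hF
  refine ⟨lam, hlam, ?_, ?_⟩
  · intro K hK x x' hx
    have hx0 : ∀ m ∈ K, content F k r ρ lam (x - x') m = 0 := by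
      intro m hm
      rw [MSRAux.content_sub, hx m hm, sub_self]
    have hcard : (K.toLeft)ᶜ.card ≤ K.toRight.card := by
      have h1 := Finset.card_toLeft_add_card_toRight (u := K)
      rw [Finset.card_compl, Fintype.card_fin]
      omega
    obtain ⟨e, he1, he2, he3, he4⟩ := MSRAux.exists_partial_inj _ _ hcard
    rw [← sub_eq_zero]
    apply hgen (fun p => e p.1)
    · intro p q i h1 h2
      exact he4 _ _ _ h1 h2
    · intro j v hj
      by_cases hjK : j ∈ K.toLeft
      · exact congrFun (hx0 (Sum.inl j) (by simpa using hjK)) v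
      · obtain ⟨b, -, hb⟩ := he2 j (by simpa using hjK)
        simp only [hb] at hj
        cases hj
    · intro j v i hi
      have hiK := he3 _ _ hi
      have := congrFun (hx0 (Sum.inr i) (by simpa using hiK)) (v + shift k r ρ i j)
      simpa [content] using this
  · intro f D hfD hD
    have hLR := Finset.card_toLeft_add_card_toRight (u := D)
    have hfL : f ∉ D.toLeft := by simpa using hfD
    have hins : (insert f D.toLeft).card = D.toLeft.card + 1 := Finset.card_insert_of_notMem hfL
    have hins2 : (insert f D.toLeft).card ≤ k := by
      simpa using Finset.card_le_univ (insert f D.toLeft)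
    obtain ⟨R0, hR0, hR0c⟩ := Finset.exists_subset_card_eq (s := D.toRight) (n := ρ) (by omega)
    let R : ParitySets r ρ := ⟨R0, hR0c⟩
    have hcard : (insert f D.toLeft)ᶜ.card ≤ (D.toRight \ R0).card := by
      rw [Finset.card_compl, Fintype.card_fin, Finset.card_sdiff_of_subset hR0]
      omega
    obtain ⟨e, he1, he2, he3, he4⟩ := MSRAux.exists_partial_inj _ _ hcard
    obtain ⟨en, hen⟩ := MSRAux.exists_enum k r ρ hρ2 (f, R)
    choose τ hτR hτ using fun z : ZMod ρ => MSRAux.omega_surj r ρ R (-z)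
    refine ⟨fun _ => LinearMap.funLeft F F en, ?_⟩
    intro x x' hx
    have hx0 : ∀ m ∈ D, ∀ v : Lbl k r ρ, v (f, R) = 0 →
        content F k r ρ lam (x - x') m v = 0 := by
      intro m hm v hv
      obtain ⟨t, rfl⟩ := hen v hv
      have := congrFun (hx m hm) t
      simp only [LinearMap.funLeft_apply] at this
      rw [MSRAux.content_sub, Pi.sub_apply, this, sub_self]
    have hshift : ∀ (i : Fin r) (j : Fin k), j ≠ f → shift k r ρ i j (f, R) = 0 := by
      intro i j hj
      simp [shift, hj.symm]
    -- truncated difference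
    have hy := hgen
      (fun p => if p.1 = f then some (τ (p.2 (f, R))) else if p.2 (f, R) = 0 then e p.1 else none)
      (by
        rintro ⟨j, v⟩ ⟨j', v'⟩ i h1 h2
        simp only at h1 h2 ⊢
        have key : ∀ (a b : Fin k) (w w' : Lbl k r ρ), a = f → b ≠ f →
            (if a = f then some (τ (w (f, R))) else if w (f, R) = 0 then e a else none) = some i →
            (if b = f then some (τ (w' (f, R))) else if w' (f, R) = 0 then e b else none) = some i →
            False := by
          intro a b w w' ha hb ha1 hb1
          rw [if_pos ha, Option.some.injEq] at ha1
          rw [if_neg hb] at hb1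
          split_ifs at hb1 with hw
          have := he3 _ _ hb1
          rw [← ha1] at this
          exact (Finset.mem_sdiff.mp this).2 (hτR _)
        by_cases hj : j = f
        · by_cases hj' : j' = f
          · rw [hj, hj']
          · exact (key j j' v v' hj hj' h1 h2).elim
        · by_cases hj' : j' = f
          · exact (key j' j v' v hj' hj h2 h1).elim
          · rw [if_neg hj] at h1
            rw [if_neg hj'] at h2
            split_ifs at h1 h2
            exact he4 _ _ _ h1 h2)
      (fun j v => if j = f ∨ v (f, R) = 0 then (x - x') j v else 0)
      (by
        intro j v h
        simp only at h
        split_ifs at h with h1 h2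
        · by_cases hjD : j ∈ D.toLeft
          · simp only [h2, or_true, if_true]
            exact hx0 (Sum.inl j) (by simpa using hjD) v h2
          · obtain ⟨b, -, hb⟩ := he2 j (by simp [h1, hjD])
            rw [hb] at h
            cases h
        · simp [h1, h2])
      (by
        intro j v i h
        simp only at h
        have hmain : i ∈ D.toRight ∧ (v + shift k r ρ i j) (f, R) = 0 := by
          split_ifs at h with h1 h2
          · rw [Option.some.injEq] at h
            subst h1
            refine ⟨hR0 (h ▸ hτR _), ?_⟩
            rw [← h]
            simp [shift, hτ]
          · refine ⟨(Finset.mem_sdiff.mp (he3 _ _ h)).1, ?_⟩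
            rw [Pi.add_apply, hshift _ _ h1, h2, add_zero]
        have h0 := hx0 (Sum.inr i) (by simpa using hmain.1) _ hmain.2
        simp only [content] at h0
        rw [← h0]
        apply Finset.sum_congr rfl
        intro j' _
        rw [if_pos]
        by_cases hj' : j' = f
        · exact Or.inl hj'
        · right
          rw [Pi.sub_apply, hmain.2, hshift _ _ hj', sub_zero])
    funext v
    have := congrFun (congrFun hy f) v
    simp only [true_or, if_true, Pi.sub_apply, Pi.zero_apply] at this
    exact sub_eq_zero.mp this
end
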